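/- Let X be a normed space and T : X → X a compact linear operator. Then either the homogeneous equation x − Tx = 0 has a nontrivial solution, or for each y ∈ X the equation x − Tx = y has a unique solution and the inverse operator (I − T)^{-1} is bounded. -/

import Mathlib

open UniformSpace Topology in
/-- A compact operator on a normed space extends to a compact operator on the completion, and the
extension takes its values in the original space. -/
theorem IsCompactOperator.exists_extension_completion {𝕜 X : Type*} [NontriviallyNormedField 𝕜]
    [NormedAddCommGroup X] [NormedSpace 𝕜 X] {T : X →L[𝕜] X} (hT : IsCompactOperator T) :
    ∃ S : Completion X →L[𝕜] Completion X, IsCompactOperator S ∧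
      (∀ x : X, S x = (T x : X)) ∧ ∀ z, ∃ x : X, S z = x := by
  have hι : IsDenseInducing (Completion.toComplL : X →L[𝕜] Completion X) :=
    Completion.isDenseInducing_coe
  let S : Completion X →L[𝕜] Completion X :=
    ((Completion.toComplL : X →L[𝕜] Completion X).comp T).extend Completion.toComplL
  have hS (x : X) : S x = (T x : X) :=
    ContinuousLinearMap.extend_eq _ hι.dense (Completion.isUniformInducing_coe X) x
  obtain ⟨K, hK, hKT⟩ := hT
  have hιK : IsCompact ((↑) '' K : Set (Completion X)) := hK.image (Completion.continuous_coe X)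
  have hSK : S ⁻¹' ((↑) '' K) ∈ 𝓝 (0 : Completion X) := by
    have h := hι.closure_image_mem_nhds hKT
    rw [map_zero] at h
    refine Filter.mem_of_superset h (closure_minimal ?_ (hιK.isClosed.preimage S.continuous))
    rintro _ ⟨x, hx, rfl⟩
    exact ⟨T x, hx, (hS x).symm⟩
  refine ⟨S, ⟨_, hιK, hSK⟩, hS, fun z ↦ ?_⟩
  have htop : ((Completion.toComplL : X →L[𝕜] Completion X).range.comap S.toLinearMap) = ⊤ := by
    refine Submodule.eq_top_of_nonempty_interior' _ ⟨0, mem_interior_iff_mem_nhds.2 ?_⟩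
    refine Filter.mem_of_superset hSK ?_
    rintro w ⟨x, -, hx⟩
    exact ⟨x, hx⟩
  obtain ⟨x, hx⟩ := (htop ▸ Submodule.mem_top :
    z ∈ (Completion.toComplL : X →L[𝕜] Completion X).range.comap S.toLinearMap)
  exact ⟨x, hx.symm⟩

/-- the Fredholm alternative. For a compact linear operator `T`
on a normed space `X`, either `x − Tx = 0` has a nontrivial solution, or for
each `y` the equation `x − Tx = y` has a unique solution and `(I − T)⁻¹` is
bounded. -/
theorem fredholm_alternative (X : Type*) [NormedAddCommGroup X] [NormedSpace ℝ X]
    (T : X →L[ℝ] X) (hT : IsCompactOperator T) :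
    (∃ x : X, x ≠ 0 ∧ x - T x = 0) ∨
      ((∀ y : X, ∃! x : X, x - T x = y) ∧
        ∃ C : ℝ, 0 ≤ C ∧ ∀ x : X, ‖x‖ ≤ C * ‖x - T x‖) := by
  refine or_iff_not_imp_left.2 fun hker ↦ ?_
  have hT_eig : ¬ Module.End.HasEigenvalue (T : Module.End ℝ X) 1 := fun h ↦ by
    obtain ⟨x, hx⟩ := h.exists_hasEigenvector
    have hTx : T x = x := by simpa using hx.apply_eq_smul
    exact hker ⟨x, hx.2, by rw [hTx, sub_self]⟩
  obtain ⟨C, hC⟩ := hT.antilipschitz_of_not_hasEigenvalue one_ne_zero hT_eig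
  have hbound (x : X) : ‖x‖ ≤ C * ‖x - T x‖ := by
    simpa [norm_sub_rev] using hC.le_mul_dist x 0
  refine ⟨fun y ↦ ?_, C, C.2, hbound⟩
  obtain ⟨S, hS, hST, hSX⟩ := hT.exists_extension_completion
  have hS_res : (1 : ℝ) ∈ resolventSet ℝ S := by
    refine (hS.hasEigenvalue_or_mem_resolventSet one_ne_zero).resolve_left fun h ↦ ?_
    obtain ⟨z, hz⟩ := h.exists_hasEigenvector
    have hSz : S z = z := by simpa using hz.apply_eq_smul
    obtain ⟨x, hx⟩ := hSX z
    obtain rfl : z = x := hSz.symm.trans hx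
    rw [hST, UniformSpace.Completion.coe_inj] at hSz
    exact hker ⟨x, fun h0 ↦ hz.2 (by simp [h0]), by rw [hSz, sub_self]⟩
  have hbij := ContinuousLinearMap.isUnit_iff_bijective.1 (spectrum.mem_resolventSet_iff.1 hS_res)
  obtain ⟨z, hz⟩ := hbij.2 (y : UniformSpace.Completion X)
  replace hz : z - S z = y := by simpa using hz
  obtain ⟨w, hw⟩ := hSX z
  obtain rfl : z = ((y + w : X) : UniformSpace.Completion X) := by
    rw [UniformSpace.Completion.coe_add, ← hw, ← hz, sub_add_cancel]
  rw [hST, ← UniformSpace.Completion.coe_sub, UniformSpace.Completion.coe_inj] at hz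
  refine ⟨y + w, hz, fun x hx ↦ sub_eq_zero.1 (norm_le_zero_iff.1 ?_)⟩
  have hdiff : x - (y + w) - T (x - (y + w)) = 0 := by
    rw [map_sub, sub_sub_sub_comm, hx, hz, sub_self]
  exact (hbound _).trans_eq (by rw [hdiff, norm_zero, mul_zero])
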